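/- Let n ≥ 1, let α_1,…,α_n be programs containing no variables, and let φ_1,…,φ_n, ψ_1,…,ψ_n be variable-free formulas. Let σ(x) = ⟨α_1⟩(φ_1 ∧ (ψ_1 ∨ ⟨α_2⟩(φ_2 ∧ (ψ_2 ∨ … ⟨α_n⟩(φ_n ∧ (ψ_n ∨ x)) … )))) (the negation-dual of the odd Π^x-form, so σ(x) ∈ Σ^x_{2n'+1} for the appropriate n'). Then λ_4 := ⟨(⨀_{i=1}^n α_i;φ_i?)*⟩ ⋁_{j=1}^n ⟨⨀_{k=1}^j α_k;φ_k?⟩ ψ_j is a solution to the fixed-point equation x ≡ σ(x); that is, λ_4 contains no occurrence of x and λ_4 ≡ σ(λ_4) is valid. -/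

import Mathlib

mutual
inductive PDLFormula (P V A : Type) : Type
  | var : V → PDLFormula P V A
  | atom : P → PDLFormula P V A
  | natom : P → PDLFormula P V A
  | or : PDLFormula P V A → PDLFormula P V A → PDLFormula P V A
  | and : PDLFormula P V A → PDLFormula P V A → PDLFormula P V A
  | dia : PDLProgram P V A → PDLFormula P V A → PDLFormula P V A
  | box : PDLProgram P V A → PDLFormula P V A → PDLFormula P V A

inductive PDLProgram (P V A : Type) : Type
  | aprog : A → PDLProgram P V A
  | test : PDLFormula P V A → PDLProgram P V A
  | seq : PDLProgram P V A → PDLProgram P V A → PDLProgram P V A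
  | union : PDLProgram P V A → PDLProgram P V A → PDLProgram P V A
  | star : PDLProgram P V A → PDLProgram P V A
end

structure PDLModel (P V A : Type) where
  W : Type
  nonempty : Nonempty W
  R : A → W → W → Prop
  Vp : P → Set W
  Vv : V → Set W

mutual
def PDLModel.Sat {P V A : Type} (M : PDLModel P V A) : PDLFormula P V A → M.W → Prop
  | .var x => fun w => w ∈ M.Vv x
  | .atom p => fun w => w ∈ M.Vp p
  | .natom p => fun w => w ∉ M.Vp p
  | .or φ ψ => fun w => M.Sat φ w ∨ M.Sat ψ w
  | .and φ ψ => fun w => M.Sat φ w ∧ M.Sat ψ w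
  | .dia α φ => fun w => ∃ u, M.Rel α w u ∧ M.Sat φ u
  | .box α φ => fun w => ∀ u, M.Rel α w u → M.Sat φ u

def PDLModel.Rel {P V A : Type} (M : PDLModel P V A) : PDLProgram P V A → M.W → M.W → Prop
  | .aprog a => M.R a
  | .test φ => fun w u => w = u ∧ M.Sat φ w
  | .seq α β => fun w u => ∃ v, M.Rel α w v ∧ M.Rel β v u
  | .union α β => fun w u => M.Rel α w u ∨ M.Rel β w u
  | .star α => Relation.ReflTransGen (M.Rel α)
end

def PDLFormula.nneg {P V A : Type} : PDLFormula P V A → PDLFormula P V A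
  | .var x => .var x
  | .atom p => .natom p
  | .natom p => .atom p
  | .or φ ψ => .and φ.nneg ψ.nneg
  | .and φ ψ => .or φ.nneg ψ.nneg
  | .dia α φ => .box α φ.nneg
  | .box α φ => .dia α φ.nneg

mutual
def PDLFormula.noVar {P V A : Type} : PDLFormula P V A → Prop
  | .var _ => False
  | .atom _ => True
  | .natom _ => True
  | .or φ ψ => φ.noVar ∧ ψ.noVar
  | .and φ ψ => φ.noVar ∧ ψ.noVar
  | .dia α φ => α.noVar ∧ φ.noVar
  | .box α φ => α.noVar ∧ φ.noVar

def PDLProgram.noVar {P V A : Type} : PDLProgram P V A → Prop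
  | .aprog _ => True
  | .test φ => φ.noVar
  | .seq α β => α.noVar ∧ β.noVar
  | .union α β => α.noVar ∧ β.noVar
  | .star α => α.noVar
end

mutual
def PDLFormula.xFree {P V A : Type} (x : V) : PDLFormula P V A → Prop
  | .var y => y ≠ x
  | .atom _ => True
  | .natom _ => True
  | .or φ ψ => φ.xFree x ∧ ψ.xFree x
  | .and φ ψ => φ.xFree x ∧ ψ.xFree x
  | .dia α φ => α.xFree x ∧ φ.xFree x
  | .box α φ => α.xFree x ∧ φ.xFree x

def PDLProgram.xFree {P V A : Type} (x : V) : PDLProgram P V A → Prop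
  | .aprog _ => True
  | .test φ => φ.xFree x
  | .seq α β => α.xFree x ∧ β.xFree x
  | .union α β => α.xFree x ∧ β.xFree x
  | .star α => α.xFree x
end

mutual
def PDLFormula.subst {P V A : Type} [DecidableEq V] (x : V) (ψ : PDLFormula P V A) :
    PDLFormula P V A → PDLFormula P V A
  | .var y => if y = x then ψ else .var y
  | .atom p => .atom p
  | .natom p => .natom p
  | .or φ χ => .or (PDLFormula.subst x ψ φ) (PDLFormula.subst x ψ χ)
  | .and φ χ => .and (PDLFormula.subst x ψ φ) (PDLFormula.subst x ψ χ)
  | .dia α φ => .dia (PDLProgram.subst x ψ α) (PDLFormula.subst x ψ φ)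
  | .box α φ => .box (PDLProgram.subst x ψ α) (PDLFormula.subst x ψ φ)

def PDLProgram.subst {P V A : Type} [DecidableEq V] (x : V) (ψ : PDLFormula P V A) :
    PDLProgram P V A → PDLProgram P V A
  | .aprog a => .aprog a
  | .test φ => .test (PDLFormula.subst x ψ φ)
  | .seq α β => .seq (PDLProgram.subst x ψ α) (PDLProgram.subst x ψ β)
  | .union α β => .union (PDLProgram.subst x ψ α) (PDLProgram.subst x ψ β)
  | .star α => .star (PDLProgram.subst x ψ α)
end

/-- Nested box form: `[α_i](φ_i ∨ (ψ_i ∧ [α_{i+1}](…)))` with `m` levels starting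
at index `i`, and the variable `x` innermost. -/
def nestBoxOr {P V A : Type} (αs : ℕ → PDLProgram P V A) (φs ψs : ℕ → PDLFormula P V A)
    (x : V) : ℕ → ℕ → PDLFormula P V A
  | 0, _ => .var x
  | m + 1, i => .box (αs i) (.or (φs i) (.and (ψs i) (nestBoxOr αs φs ψs x m (i + 1))))

/-- Nested diamond form: `⟨α_i⟩(φ_i ∧ (ψ_i ∨ ⟨α_{i+1}⟩(…)))` with `m` levels starting
at index `i`, and the variable `x` innermost. -/
def nestDiaAnd {P V A : Type} (αs : ℕ → PDLProgram P V A) (φs ψs : ℕ → PDLFormula P V A)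
    (x : V) : ℕ → ℕ → PDLFormula P V A
  | 0, _ => .var x
  | m + 1, i => .dia (αs i) (.and (φs i) (.or (ψs i) (nestDiaAnd αs φs ψs x m (i + 1))))

/-- `seqPrefFrom base step j = base ; step 2 ; step 3 ; … ; step j` (left associated);
for `j ≤ 1` it is just `base`. -/
def seqPrefFrom {P V A : Type} (base : PDLProgram P V A) (step : ℕ → PDLProgram P V A) :
    ℕ → PDLProgram P V A
  | 0 => base
  | 1 => base
  | j + 2 => .seq (seqPrefFrom base step (j + 1)) (step (j + 2))

/-- `bigAndUp χ n = χ 1 ∧ χ 2 ∧ … ∧ χ n` (left associated); `bigAndUp χ 1 = χ 1`. -/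
def bigAndUp {P V A : Type} (χ : ℕ → PDLFormula P V A) : ℕ → PDLFormula P V A
  | 0 => χ 0
  | 1 => χ 1
  | j + 2 => .and (bigAndUp χ (j + 1)) (χ (j + 2))

/-- `bigOrUp χ n = χ 1 ∨ χ 2 ∨ … ∨ χ n` (left associated); `bigOrUp χ 1 = χ 1`. -/
def bigOrUp {P V A : Type} (χ : ℕ → PDLFormula P V A) : ℕ → PDLFormula P V A
  | 0 => χ 0
  | 1 => χ 1
  | j + 2 => .or (bigOrUp χ (j + 1)) (χ (j + 2))

mutual
theorem PDLFormula.xFree_of_noVar {P V A : Type} (x : V) :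
    ∀ φ : PDLFormula P V A, φ.noVar → φ.xFree x
  | .var _, h => by simp [PDLFormula.noVar] at h
  | .atom _, _ => by simp [PDLFormula.xFree]
  | .natom _, _ => by simp [PDLFormula.xFree]
  | .or φ ψ, h => by
      simp only [PDLFormula.noVar, PDLFormula.xFree] at h ⊢
      exact ⟨PDLFormula.xFree_of_noVar x φ h.1, PDLFormula.xFree_of_noVar x ψ h.2⟩
  | .and φ ψ, h => by
      simp only [PDLFormula.noVar, PDLFormula.xFree] at h ⊢
      exact ⟨PDLFormula.xFree_of_noVar x φ h.1, PDLFormula.xFree_of_noVar x ψ h.2⟩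
  | .dia α φ, h => by
      simp only [PDLFormula.noVar, PDLFormula.xFree] at h ⊢
      exact ⟨PDLProgram.xFree_of_noVar x α h.1, PDLFormula.xFree_of_noVar x φ h.2⟩
  | .box α φ, h => by
      simp only [PDLFormula.noVar, PDLFormula.xFree] at h ⊢
      exact ⟨PDLProgram.xFree_of_noVar x α h.1, PDLFormula.xFree_of_noVar x φ h.2⟩

theorem PDLProgram.xFree_of_noVar {P V A : Type} (x : V) :
    ∀ α : PDLProgram P V A, α.noVar → α.xFree x
  | .aprog _, _ => by simp [PDLProgram.xFree]
  | .test φ, h => by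
      simp only [PDLProgram.noVar, PDLProgram.xFree] at h ⊢
      exact PDLFormula.xFree_of_noVar x φ h
  | .seq α β, h => by
      simp only [PDLProgram.noVar, PDLProgram.xFree] at h ⊢
      exact ⟨PDLProgram.xFree_of_noVar x α h.1, PDLProgram.xFree_of_noVar x β h.2⟩
  | .union α β, h => by
      simp only [PDLProgram.noVar, PDLProgram.xFree] at h ⊢
      exact ⟨PDLProgram.xFree_of_noVar x α h.1, PDLProgram.xFree_of_noVar x β h.2⟩
  | .star α, h => by
      simp only [PDLProgram.noVar, PDLProgram.xFree] at h ⊢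
      exact PDLProgram.xFree_of_noVar x α h
end

mutual
theorem PDLFormula.subst_eq_self {P V A : Type} [DecidableEq V] (x : V)
    (χ : PDLFormula P V A) : ∀ φ : PDLFormula P V A, φ.xFree x → PDLFormula.subst x χ φ = φ
  | .var y, h => by
      simp only [PDLFormula.xFree] at h
      simp [PDLFormula.subst, h]
  | .atom _, _ => by simp [PDLFormula.subst]
  | .natom _, _ => by simp [PDLFormula.subst]
  | .or φ ψ, h => by
      simp only [PDLFormula.xFree] at h
      rw [PDLFormula.subst, PDLFormula.subst_eq_self x χ φ h.1,
        PDLFormula.subst_eq_self x χ ψ h.2]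
  | .and φ ψ, h => by
      simp only [PDLFormula.xFree] at h
      rw [PDLFormula.subst, PDLFormula.subst_eq_self x χ φ h.1,
        PDLFormula.subst_eq_self x χ ψ h.2]
  | .dia α φ, h => by
      simp only [PDLFormula.xFree] at h
      rw [PDLFormula.subst, PDLProgram.subst_eq_self x χ α h.1,
        PDLFormula.subst_eq_self x χ φ h.2]
  | .box α φ, h => by
      simp only [PDLFormula.xFree] at h
      rw [PDLFormula.subst, PDLProgram.subst_eq_self x χ α h.1,
        PDLFormula.subst_eq_self x χ φ h.2]

theorem PDLProgram.subst_eq_self {P V A : Type} [DecidableEq V] (x : V)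
    (χ : PDLFormula P V A) : ∀ α : PDLProgram P V A, α.xFree x → PDLProgram.subst x χ α = α
  | .aprog _, _ => by simp [PDLProgram.subst]
  | .test φ, h => by
      simp only [PDLProgram.xFree] at h
      rw [PDLProgram.subst, PDLFormula.subst_eq_self x χ φ h]
  | .seq α β, h => by
      simp only [PDLProgram.xFree] at h
      rw [PDLProgram.subst, PDLProgram.subst_eq_self x χ α h.1,
        PDLProgram.subst_eq_self x χ β h.2]
  | .union α β, h => by
      simp only [PDLProgram.xFree] at h
      rw [PDLProgram.subst, PDLProgram.subst_eq_self x χ α h.1,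
        PDLProgram.subst_eq_self x χ β h.2]
  | .star α, h => by
      simp only [PDLProgram.xFree] at h
      rw [PDLProgram.subst, PDLProgram.subst_eq_self x χ α h]
end

theorem seqPrefFrom_xFree {P V A : Type} (x : V) (step : ℕ → PDLProgram P V A) (j : ℕ)
    (hj : 1 ≤ j) (h : ∀ i, 1 ≤ i → i ≤ j → (step i).xFree x) :
    (seqPrefFrom (step 1) step j).xFree x := by
  induction j, hj using Nat.le_induction with
  | base => exact h 1 le_rfl le_rfl
  | succ j hj ih =>
    obtain ⟨k, rfl⟩ := Nat.exists_eq_add_of_le' hj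
    simp only [seqPrefFrom, PDLProgram.xFree]
    exact ⟨ih fun i h1 h2 => h i h1 (by omega), h _ (by omega) le_rfl⟩

theorem bigOrUp_xFree {P V A : Type} (x : V) (χ : ℕ → PDLFormula P V A) (n : ℕ)
    (hn : 1 ≤ n) (h : ∀ i, 1 ≤ i → i ≤ n → (χ i).xFree x) : (bigOrUp χ n).xFree x := by
  induction n, hn using Nat.le_induction with
  | base => exact h 1 le_rfl le_rfl
  | succ j hj ih =>
    obtain ⟨k, rfl⟩ := Nat.exists_eq_add_of_le' hj
    simp only [bigOrUp, PDLFormula.xFree]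
    exact ⟨ih fun i h1 h2 => h i h1 (by omega), h _ (by omega) le_rfl⟩

theorem PDLModel.sat_bigOrUp {P V A : Type} (M : PDLModel P V A) (χ : ℕ → PDLFormula P V A)
    (n : ℕ) (hn : 1 ≤ n) (w : M.W) :
    M.Sat (bigOrUp χ n) w ↔ ∃ j, 1 ≤ j ∧ j ≤ n ∧ M.Sat (χ j) w := by
  induction n, hn using Nat.le_induction with
  | base =>
    refine ⟨fun h => ⟨1, le_rfl, le_rfl, h⟩, ?_⟩
    rintro ⟨j, h1, h2, h⟩
    obtain rfl : j = 1 := by omega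
    exact h
  | succ j hj ih =>
    obtain ⟨k, rfl⟩ := Nat.exists_eq_add_of_le' hj
    simp only [bigOrUp, PDLModel.Sat, ih]
    constructor
    · rintro (⟨i, h1, h2, h⟩ | h)
      · exact ⟨i, h1, by omega, h⟩
      · exact ⟨_, by omega, le_rfl, h⟩
    · rintro ⟨i, h1, h2, h⟩
      rcases h2.lt_or_eq with h2 | rfl
      · exact Or.inl ⟨i, h1, by omega, h⟩
      · exact Or.inr h

theorem PDLModel.rel_seq_test {P V A : Type} (M : PDLModel P V A) (α : PDLProgram P V A)
    (φ : PDLFormula P V A) (w u : M.W) :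
    M.Rel (.seq α (.test φ)) w u ↔ M.Rel α w u ∧ M.Sat φ u := by
  simp only [PDLModel.Rel]
  constructor
  · rintro ⟨v, h, rfl, h'⟩
    exact ⟨h, h'⟩
  · rintro ⟨h, h'⟩
    exact ⟨u, h, rfl, h'⟩

theorem PDLModel.rel_seqPrefFrom_succ {P V A : Type} (M : PDLModel P V A)
    (base : PDLProgram P V A) (step : ℕ → PDLProgram P V A) (j : ℕ) (hj : 1 ≤ j) (w u : M.W) :
    M.Rel (seqPrefFrom base step (j + 1)) w u ↔
      ∃ v, M.Rel (seqPrefFrom base step j) w v ∧ M.Rel (step (j + 1)) v u := by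
  obtain ⟨k, rfl⟩ := Nat.exists_eq_add_of_le' hj
  simp only [seqPrefFrom, PDLModel.Rel]

/-- Unfolding the levels `j + 1, …, j + m` of the nested diamond form behind the prefix of
length `j`. -/
theorem PDLModel.exists_rel_seqPrefFrom_nestDiaAnd {P V A : Type} [DecidableEq V]
    (M : PDLModel P V A) (x : V) (χ : PDLFormula P V A) (αs : ℕ → PDLProgram P V A)
    (φs ψs : ℕ → PDLFormula P V A) (base : PDLProgram P V A) (w : M.W) (m j : ℕ) (hj : 1 ≤ j)
    (hα : ∀ i, j ≤ i → i ≤ j + m → (αs i).noVar)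
    (hφ : ∀ i, j ≤ i → i ≤ j + m → (φs i).noVar)
    (hψ : ∀ i, j ≤ i → i ≤ j + m → (ψs i).noVar) :
    (∃ u, M.Rel (seqPrefFrom base (fun i => .seq (αs i) (.test (φs i))) j) w u ∧
      (M.Sat (ψs j) u ∨ M.Sat (PDLFormula.subst x χ (nestDiaAnd αs φs ψs x m (j + 1))) u)) ↔
    (∃ k, j ≤ k ∧ k ≤ j + m ∧ ∃ u,
      M.Rel (seqPrefFrom base (fun i => .seq (αs i) (.test (φs i))) k) w u ∧ M.Sat (ψs k) u) ∨
    ∃ u, M.Rel (seqPrefFrom base (fun i => .seq (αs i) (.test (φs i))) (j + m)) w u ∧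
      M.Sat χ u := by
  induction m generalizing j with
  | zero =>
    simp only [nestDiaAnd, PDLFormula.subst, if_true, Nat.add_zero]
    constructor
    · rintro ⟨u, h, h' | h'⟩
      · exact Or.inl ⟨j, le_rfl, le_rfl, u, h, h'⟩
      · exact Or.inr ⟨u, h, h'⟩
    · rintro (⟨k, h1, h2, u, h, h'⟩ | ⟨u, h, h'⟩)
      · obtain rfl : k = j := by omega
        exact ⟨u, h, Or.inl h'⟩
      · exact ⟨u, h, Or.inr h'⟩
  | succ m ih =>
    have key := ih (j + 1) (by omega) (fun i h1 h2 => hα i (by omega) (by omega))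
      (fun i h1 h2 => hφ i (by omega) (by omega)) (fun i h1 h2 => hψ i (by omega) (by omega))
    rw [show j + 1 + m = j + (m + 1) by omega] at key
    have eα := PDLProgram.subst_eq_self x χ _
      (PDLProgram.xFree_of_noVar x _ (hα (j + 1) (by omega) (by omega)))
    have eφ := PDLFormula.subst_eq_self x χ _
      (PDLFormula.xFree_of_noVar x _ (hφ (j + 1) (by omega) (by omega)))
    have eψ := PDLFormula.subst_eq_self x χ _
      (PDLFormula.xFree_of_noVar x _ (hψ (j + 1) (by omega) (by omega)))
    simp only [M.rel_seqPrefFrom_succ _ _ j hj, M.rel_seq_test] at key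
    simp only [nestDiaAnd, PDLFormula.subst, eα, eφ, eψ, PDLModel.Sat]
    constructor
    · rintro ⟨u, h, h' | ⟨v, h1, h2, h3⟩⟩
      · exact Or.inl ⟨j, le_rfl, by omega, u, h, h'⟩
      · rcases key.1 ⟨v, ⟨u, h, h1, h2⟩, h3⟩ with ⟨k, hk, hk', h⟩ | h
        · exact Or.inl ⟨k, by omega, hk', h⟩
        · exact Or.inr h
    · intro h
      by_cases hkey : ∃ u, M.Rel (seqPrefFrom base
          (fun i => .seq (αs i) (.test (φs i))) j) w u ∧ M.Sat (ψs j) u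
      · obtain ⟨u, h, h'⟩ := hkey
        exact ⟨u, h, Or.inl h'⟩
      · obtain ⟨v, ⟨u, hu, h1, h2⟩, h3⟩ := key.2 (h.imp_left fun ⟨k, hk, hk', hs⟩ =>
          ⟨k, (hk.lt_or_eq.resolve_right fun e => hkey (e ▸ hs)), hk', hs⟩)
        exact ⟨u, hu, Or.inr ⟨v, h1, h2, h3⟩⟩

/-- for `n ≥ 1`, variable-free programs `α_1,…,α_n` and variable-free
formulas `φ_1,…,φ_n,ψ_1,…,ψ_n`, the formula
`λ₄ = ⟨(⨀_{i=1}^n α_i;φ_i?)*⟩ ⋁_{j=1}^n ⟨⨀_{k=1}^j α_k;φ_k?⟩ ψ_j`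
is a solution of `x ≡ ⟨α_1⟩(φ_1 ∧ (ψ_1 ∨ ⟨α_2⟩(φ_2 ∧ (ψ_2 ∨ … ⟨α_n⟩(φ_n ∧ (ψ_n ∨ x))…))))`. -/
theorem lambda4_solves_odd_Sigma_form {P V A : Type} [DecidableEq V]
    (x : V) (n : ℕ) (hn : 1 ≤ n)
    (αs : ℕ → PDLProgram P V A) (φs ψs : ℕ → PDLFormula P V A)
    (hα : ∀ i, 1 ≤ i → i ≤ n → (αs i).noVar)
    (hφ : ∀ i, 1 ≤ i → i ≤ n → (φs i).noVar)
    (hψ : ∀ i, 1 ≤ i → i ≤ n → (ψs i).noVar) :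
    let step : ℕ → PDLProgram P V A := fun i => .seq (αs i) (.test (φs i))
    let lam : PDLFormula P V A :=
      .dia (.star (seqPrefFrom (step 1) step n))
        (bigOrUp (fun j => .dia (seqPrefFrom (step 1) step j) (ψs j)) n)
    let σx : PDLFormula P V A := nestDiaAnd αs φs ψs x n 1
    lam.xFree x ∧
      ∀ (M : PDLModel P V A) (w : M.W),
        M.Sat lam w ↔ M.Sat (PDLFormula.subst x lam σx) w := by
  intro step lam σx
  have hstep : ∀ i, 1 ≤ i → i ≤ n → (step i).xFree x := fun i h1 h2 => by
    simp only [step, PDLProgram.xFree]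
    exact ⟨PDLProgram.xFree_of_noVar x _ (hα i h1 h2), PDLFormula.xFree_of_noVar x _ (hφ i h1 h2)⟩
  refine ⟨?_, fun M w => ?_⟩
  · simp only [lam, PDLFormula.xFree, PDLProgram.xFree]
    refine ⟨seqPrefFrom_xFree x step n hn hstep, bigOrUp_xFree x _ n hn fun i h1 h2 => ?_⟩
    simp only [PDLFormula.xFree]
    exact ⟨seqPrefFrom_xFree x step i h1 fun k hk hk' => hstep k hk (by omega),
      PDLFormula.xFree_of_noVar x _ (hψ i h1 h2)⟩
  · have hσ : M.Sat (PDLFormula.subst x lam σx) w ↔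
        (∃ k, 1 ≤ k ∧ k ≤ n ∧ ∃ u, M.Rel (seqPrefFrom (step 1) step k) w u ∧ M.Sat (ψs k) u) ∨
        ∃ u, M.Rel (seqPrefFrom (step 1) step n) w u ∧ M.Sat lam u := by
      clear_value lam
      obtain ⟨m, rfl⟩ := Nat.exists_eq_add_of_le hn
      refine Iff.trans ?_ (M.exists_rel_seqPrefFrom_nestDiaAnd x lam αs φs ψs (step 1) w m 1
        le_rfl hα hφ hψ)
      have eα := PDLProgram.subst_eq_self x lam _
        (PDLProgram.xFree_of_noVar x _ (hα 1 le_rfl hn))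
      have eφ := PDLFormula.subst_eq_self x lam _
        (PDLFormula.xFree_of_noVar x _ (hφ 1 le_rfl hn))
      have eψ := PDLFormula.subst_eq_self x lam _
        (PDLFormula.xFree_of_noVar x _ (hψ 1 le_rfl hn))
      simp only [σx, step, Nat.add_comm 1 m, nestDiaAnd, PDLFormula.subst, eα, eφ, eψ,
        PDLModel.Sat, seqPrefFrom, M.rel_seq_test, and_assoc]
    have hlam : ∀ v, M.Sat lam v ↔
        ∃ u, Relation.ReflTransGen (M.Rel (seqPrefFrom (step 1) step n)) v u ∧
          ∃ k, 1 ≤ k ∧ k ≤ n ∧ ∃ t, M.Rel (seqPrefFrom (step 1) step k) u t ∧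
            M.Sat (ψs k) t := fun v => by
      simp only [lam, PDLModel.Sat, PDLModel.Rel, M.sat_bigOrUp _ n hn]
    rw [hσ, hlam]
    constructor
    · rintro ⟨u, h, hk⟩
      rcases h.cases_head with rfl | ⟨v, hv, hvu⟩
      · exact Or.inl hk
      · exact Or.inr ⟨v, hv, (hlam v).2 ⟨u, hvu, hk⟩⟩
    · rintro (hk | ⟨v, hv, hl⟩)
      · exact ⟨w, .refl, hk⟩
      · obtain ⟨u, hvu, hk⟩ := (hlam v).1 hl
        exact ⟨u, .head hv hvu, hk⟩
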